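/- arXiv:2503.02306 — 2 statements merged into one kernel-verified Lean document; each statement's English description precedes it below -/
import Mathlib

section
/- Let I be an open real interval containing 0 and let q̃ : I → ℝ be infinitely differentiable and strictly positive on I. Set q(t) = t·q̃(t) and Q(t) = ∫_0^t √|q(s)| ds for t ∈ I. Then there exists a function U : I → ℝ such that: U(t) = sign(t)·((3/2)·|Q(t)|)^{2/3} for all t ∈ I; U is infinitely differentiable on I; U'(t) > 0 for all t ∈ I; U(t) = 0 if and only if t = 0; and U satisfies the eikonal equation (U'(t))²·U(t) = q(t) for all t ∈ I. -/
open Set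

lemma tp_mem {a b : ℝ} (ha : a < 0) (hb : 0 < b) {x s : ℝ} (hx : x ∈ Ioo a b)
    (hs : s ∈ Icc (0:ℝ) 1) : s * x ∈ Ioo a b := by
  obtain ⟨h1, h2⟩ := hx
  obtain ⟨h3, h4⟩ := hs
  constructor
  · rcases le_total 0 x with h | h
    · have := mul_nonneg h3 h
      linarith
    · nlinarith
  · rcases le_total 0 x with h | h
    · nlinarith
    · have := mul_nonneg h3 (neg_nonneg.2 h)
      linarith

lemma tp_contOn {a b : ℝ} (ha : a < 0) (hb : 0 < b) {g w : ℝ → ℝ}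
    (hg : ContinuousOn g (Ioo a b)) (hw : Continuous w) {x : ℝ} (hx : x ∈ Ioo a b) :
    ContinuousOn (fun s => w s * g (s * x)) (Icc 0 1) := by
  refine hw.continuousOn.mul (hg.comp (by fun_prop) ?_)
  intro s hs
  exact tp_mem ha hb hx hs

lemma tp_int {a b : ℝ} (ha : a < 0) (hb : 0 < b) {g w : ℝ → ℝ}
    (hg : ContinuousOn g (Ioo a b)) (hw : Continuous w) {x : ℝ} (hx : x ∈ Ioo a b) :
    IntervalIntegrable (fun s => w s * g (s * x)) MeasureTheory.volume 0 1 := by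
  apply ContinuousOn.intervalIntegrable
  rw [uIcc_of_le zero_le_one]
  exact tp_contOn ha hb hg hw hx

lemma tp_deriv_g {a b : ℝ} {g : ℝ → ℝ}
    (hg : ContDiffOn ℝ (⊤ : ℕ∞) g (Ioo a b)) {x : ℝ} (hx : x ∈ Ioo a b) :
    HasDerivAt g (deriv g x) x :=
  ((hg.contDiffAt (isOpen_Ioo.mem_nhds hx)).differentiableAt (by simp)).hasDerivAt

lemma tp_smooth_deriv {a b : ℝ} {g : ℝ → ℝ}
    (hg : ContDiffOn ℝ (⊤ : ℕ∞) g (Ioo a b)) : ContDiffOn ℝ (⊤ : ℕ∞) (deriv g) (Ioo a b) :=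
  ((contDiffOn_infty_iff_deriv_of_isOpen isOpen_Ioo).1 hg).2

lemma tp_hasDeriv {a b : ℝ} (ha : a < 0) (hb : 0 < b) {g w : ℝ → ℝ}
    (hg : ContDiffOn ℝ (⊤ : ℕ∞) g (Ioo a b)) (hw : Continuous w) {x : ℝ} (hx : x ∈ Ioo a b) :
    HasDerivAt (fun t => ∫ s in (0:ℝ)..1, w s * g (s * t))
      (∫ s in (0:ℝ)..1, (w s * s) * deriv g (s * x)) x := by
  have hg' := (tp_smooth_deriv hg).continuousOn
  have hw' : Continuous (fun s => w s * s) := by fun_prop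
  obtain ⟨c, hc1, hc2⟩ := exists_between (lt_min hx.1 ha)
  obtain ⟨d, hd1, hd2⟩ := exists_between (max_lt hx.2 hb)
  rw [lt_min_iff] at hc2
  rw [max_lt_iff] at hd1
  have hsub : Icc c d ⊆ Ioo a b := fun y hy => ⟨hc1.trans_le hy.1, hy.2.trans_lt hd2⟩
  obtain ⟨C, hC⟩ := (isCompact_Icc (a := c) (b := d)).exists_bound_of_continuousOn (hg'.mono hsub)
  refine (intervalIntegral.hasDerivAt_integral_of_dominated_loc_of_deriv_le
    (F := fun t s => w s * g (s * t)) (F' := fun t s => (w s * s) * deriv g (s * t))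
    (s := Ioo c d) (bound := fun s => |w s * s| * C) (isOpen_Ioo.mem_nhds ⟨hc2.1, hd1.1⟩)
    ?_ (tp_int ha hb hg.continuousOn hw hx) ?_ ?_ ?_ ?_).2
  · filter_upwards [isOpen_Ioo.mem_nhds hx] with y hy
    exact (tp_int ha hb hg.continuousOn hw hy).aestronglyMeasurable_restrict_uIoc
  · exact (tp_int ha hb hg' hw' hx).aestronglyMeasurable_restrict_uIoc
  · refine Filter.Eventually.of_forall fun s hs y hy => ?_
    rw [uIoc_of_le zero_le_one] at hs
    have := tp_mem hc2.2 hd1.2 hy ⟨hs.1.le, hs.2⟩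
    rw [norm_mul, Real.norm_eq_abs (w s * s)]
    gcongr
    exact hC _ (Ioo_subset_Icc_self this)
  · apply Continuous.intervalIntegrable
    fun_prop
  · refine Filter.Eventually.of_forall fun s hs y hy => ?_
    rw [uIoc_of_le zero_le_one] at hs
    have hm := tp_mem ha hb (hsub (Ioo_subset_Icc_self hy)) ⟨hs.1.le, hs.2⟩
    have h1 : HasDerivAt (fun y : ℝ => s * y) s y := by
      simpa using (hasDerivAt_id y).const_mul s
    have h2 := ((tp_deriv_g hg hm).comp y h1).const_mul (w s)
    refine HasDerivAt.congr_deriv h2 ?_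
    ring

lemma tp_contDiff {a b : ℝ} (ha : a < 0) (hb : 0 < b) (n : ℕ) : ∀ {g w : ℝ → ℝ},
    ContDiffOn ℝ (⊤ : ℕ∞) g (Ioo a b) → Continuous w →
    ContDiffOn ℝ n (fun t => ∫ s in (0:ℝ)..1, w s * g (s * t)) (Ioo a b) := by
  induction n with
  | zero =>
    intro g w hg hw
    refine contDiffOn_zero.2 fun x hx => ?_
    exact (tp_hasDeriv ha hb hg hw hx).continuousAt.continuousWithinAt
  | succ n ih =>
    intro g w hg hw
    push_cast
    rw [contDiffOn_succ_iff_deriv_of_isOpen isOpen_Ioo]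
    refine ⟨fun x hx => (tp_hasDeriv ha hb hg hw hx).differentiableAt.differentiableWithinAt,
      by simp, ?_⟩
    have hw' : Continuous (fun s => w s * s) := by fun_prop
    exact (ih (tp_smooth_deriv hg) hw').congr fun x hx => (tp_hasDeriv ha hb hg hw hx).deriv

/-- integration by parts identity -/
lemma tp_parts {a b : ℝ} (ha : a < 0) (hb : 0 < b) {g : ℝ → ℝ}
    (hg : ContDiffOn ℝ (⊤ : ℕ∞) g (Ioo a b)) {x : ℝ} (hx : x ∈ Ioo a b) :
    (3/2) * (∫ s in (0:ℝ)..1, √s * g (s * x)) +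
      x * (∫ s in (0:ℝ)..1, (√s * s) * deriv g (s * x)) = g x := by
  have hg' := (tp_smooth_deriv hg).continuousOn
  have hw : Continuous (fun s : ℝ => √s) := by fun_prop
  have hw' : Continuous (fun s : ℝ => √s * s) := by fun_prop
  have i1 := tp_int ha hb hg.continuousOn hw hx
  have i2 := tp_int ha hb hg' hw' hx
  have := intervalIntegral.integral_eq_sub_of_hasDerivAt
    (f := fun s : ℝ => s ^ (3/2 : ℝ) * g (s * x)) (a := 0) (b := 1)
    (f' := fun s => (3/2) * (√s * g (s * x)) + x * ((√s * s) * deriv g (s * x))) ?_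
    ((i1.const_mul _).add (i2.const_mul _))
  · rw [intervalIntegral.integral_add (i1.const_mul _) (i2.const_mul _),
      intervalIntegral.integral_const_mul, intervalIntegral.integral_const_mul] at this
    rw [this]
    simp
  · intro s hs
    rw [uIcc_of_le zero_le_one] at hs
    have hm := tp_mem ha hb hx hs
    have h1 : HasDerivAt (fun y : ℝ => y * x) x s := by
      simpa using (hasDerivAt_id s).mul_const x
    have h2 := (Real.hasDerivAt_rpow_const (x := s) (p := 3/2) (Or.inr (by norm_num))).mul
      ((tp_deriv_g hg hm).comp s h1)
    refine HasDerivAt.congr_deriv h2 ?_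
    have e1 : s ^ ((3/2 : ℝ) - 1) = √s := by
      rw [Real.sqrt_eq_rpow]; norm_num
    have e2 : s ^ (3/2 : ℝ) = √s * s := by
      rw [Real.sqrt_eq_rpow, ← Real.rpow_add_one' hs.1 (by norm_num)]; norm_num
    rw [e1, e2]
    simp only [Function.comp]
    ring

/-- For a coefficient `q(t) = t·q̃(t)` with a simple turning point at `0`, the function
`U(t) = sign(t)·((3/2)|Q(t)|)^{2/3}` is smooth, strictly increasing, vanishes exactly
at `0`, and satisfies the eikonal equation `(U')²·U = q`. -/
theorem turning_point_eikonal
    (a b : ℝ) (ha : a < 0) (hb : 0 < b)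
    (qt : ℝ → ℝ) (hsmooth : ContDiffOn ℝ (⊤ : ℕ∞) qt (Ioo a b))
    (hpos : ∀ t ∈ Ioo a b, 0 < qt t)
    (Q : ℝ → ℝ)
    (hQ : ∀ t, Q t = ∫ s in (0:ℝ)..t, Real.sqrt |s * qt s|) :
    ∃ U U' : ℝ → ℝ,
      (∀ t ∈ Ioo a b, U t = Real.sign t * ((3/2) * |Q t|) ^ ((2:ℝ)/3)) ∧
      ContDiffOn ℝ (⊤ : ℕ∞) U (Ioo a b) ∧
      ∀ t ∈ Ioo a b,
        HasDerivAt U (U' t) t ∧ 0 < U' t ∧ (U t = 0 ↔ t = 0) ∧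
        (U' t) ^ 2 * U t = t * qt t := by
  set g : ℝ → ℝ := fun t => √(qt t) with hgdef
  have hg : ContDiffOn ℝ (⊤ : ℕ∞) g (Ioo a b) := hsmooth.sqrt fun t ht => (hpos t ht).ne'
  have hgpos : ∀ t ∈ Ioo a b, 0 < g t := fun t ht => Real.sqrt_pos.2 (hpos t ht)
  have hw : Continuous (fun s : ℝ => √s) := by fun_prop
  set h : ℝ → ℝ := fun t => ∫ s in (0:ℝ)..1, √s * g (s * t) with hh
  have hhs : ContDiffOn ℝ (⊤ : ℕ∞) h (Ioo a b) :=
    contDiffOn_infty.2 fun n => tp_contDiff ha hb n hg hw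
  have hhpos : ∀ t ∈ Ioo a b, 0 < h t := by
    intro t ht
    refine intervalIntegral.intervalIntegral_pos_of_pos_on (tp_int ha hb hg.continuousOn hw ht)
      (fun s hs => mul_pos (Real.sqrt_pos.2 hs.1) ?_) zero_lt_one
    exact hgpos _ (tp_mem ha hb ht (Ioo_subset_Icc_self hs))
  have hWpos : ∀ t ∈ Ioo a b, 0 < 3/2 * h t := fun t ht => by
    have := hhpos t ht
    positivity
  have hQh : ∀ t ∈ Ioo a b, Q t = t * (√|t| * h t) := by
    intro t ht
    have := intervalIntegral.mul_integral_comp_mul_left (a := 0) (b := 1)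
      (f := fun s => √|s * qt s|) (c := t)
    rw [mul_zero, mul_one] at this
    rw [hQ, ← this]
    congr 1
    simp only [hh]
    rw [← intervalIntegral.integral_const_mul]
    apply intervalIntegral.integral_congr
    intro s hs
    rw [uIcc_of_le zero_le_one] at hs
    have hm := hpos _ (tp_mem ha hb ht hs)
    simp only [hgdef]
    rw [mul_comm t s, abs_mul, abs_mul, abs_of_pos hm, abs_of_nonneg hs.1,
      Real.sqrt_mul (mul_nonneg hs.1 (abs_nonneg t)), Real.sqrt_mul hs.1]
    ring
  refine ⟨fun t => t * (3/2 * h t) ^ ((2:ℝ)/3), fun t => (3/2 * h t) ^ (-(1:ℝ)/3) * g t,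
    ?_, ?_, ?_⟩
  · intro t ht
    have hp := hhpos t ht
    have e : 3/2 * |Q t| = |t| ^ (3/2 : ℝ) * (3/2 * h t) := by
      have : |t| ^ (3/2 : ℝ) = √|t| * |t| := by
        rw [Real.sqrt_eq_rpow, ← Real.rpow_add_one' (abs_nonneg t) (by norm_num)]; norm_num
      rw [hQh t ht, this, abs_mul, abs_mul, abs_of_pos hp, abs_of_nonneg (Real.sqrt_nonneg _)]
      ring
    rw [e, Real.mul_rpow (by positivity) (by positivity), ← Real.rpow_mul (abs_nonneg t)]
    norm_num
    rw [← mul_assoc]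
    congr 1
    rcases lt_trichotomy t 0 with h | h | h
    · rw [Real.sign_of_neg h, abs_of_neg h]; ring
    · simp [h]
    · rw [Real.sign_of_pos h, abs_of_pos h]; ring
  · exact contDiffOn_id.mul ((contDiffOn_const.mul hhs).rpow_const_of_ne
      fun t ht => (hWpos t ht).ne')
  · intro t ht
    have hW := hWpos t ht
    have hgt := hgpos t ht
    refine ⟨?_, by positivity, ?_, ?_⟩
    · have hd := (tp_hasDeriv ha hb hg hw ht).const_mul (3/2)
      have h1 := (hasDerivAt_id t).mul (hd.rpow_const (p := 2/3) (Or.inl hW.ne'))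
      have hp := tp_parts ha hb hg ht
      refine HasDerivAt.congr_deriv h1 ?_
      symm
      change 3/2 * h t + t * _ = g t at hp
      have e1 : (3/2 * h t) ^ ((2:ℝ)/3 - 1) = (3/2 * h t) ^ (-(1:ℝ)/3) := by norm_num
      have e2 : (3/2 * h t) ^ ((2:ℝ)/3) = (3/2 * h t) ^ (-(1:ℝ)/3) * (3/2 * h t) := by
        rw [← Real.rpow_add_one hW.ne']; norm_num
      change (3/2 * h t) ^ (-(1:ℝ)/3) * g t = 1 * (3/2 * h t) ^ ((2:ℝ)/3) + t * (_ * _ * (3/2 * h t) ^ ((2:ℝ)/3 - 1))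
      rw [e1, e2, ← hp]
      ring
    · have : (3/2 * h t) ^ ((2:ℝ)/3) ≠ 0 := by positivity
      simp [this]
    · have e : ((3/2 * h t) ^ (-(1:ℝ)/3)) ^ 2 * (3/2 * h t) ^ ((2:ℝ)/3) = 1 := by
        rw [← Real.rpow_natCast, ← Real.rpow_mul hW.le, ← Real.rpow_add hW]
        norm_num
      have e2 : g t ^ 2 = qt t := Real.sq_sqrt (hpos t ht).le
      calc _ = (((3/2 * h t) ^ (-(1:ℝ)/3)) ^ 2 * (3/2 * h t) ^ ((2:ℝ)/3)) * (t * g t ^ 2) := by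
            ring
        _ = _ := by rw [e, e2, one_mul]
end

section
/- Let I be an open real interval containing 0 and let f, g : I → ℝ be infinitely differentiable. Then the function h defined for t ∈ I \ {0} by h(t) = (f(t)/(sign(t)·√|t|))·∫_0^t (g(s)/√|s|) ds, and by h(0) = 2·f(0)·g(0), is infinitely differentiable on I. -/
open Set

theorem ssiq_mem {a b : ℝ} (ha : a < 0) (hb : 0 < b) {t u : ℝ} (ht : t ∈ Ioo a b)
    (hu : u ∈ Icc (0:ℝ) 1) : t * u ∈ Ioo a b := by
  obtain ⟨h1, h2⟩ := ht
  obtain ⟨h3, h4⟩ := hu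
  constructor
  · rcases le_total 0 t with h | h
    · nlinarith [mul_nonneg h h3]
    · nlinarith
  · rcases le_total 0 t with h | h
    · nlinarith
    · nlinarith

theorem ssiq_sq {u : ℝ} (hu : u ∈ Icc (0:ℝ) 1) : u ^ 2 ∈ Icc (0:ℝ) 1 :=
  ⟨by positivity, pow_le_one₀ hu.1 hu.2⟩

theorem ssiq_cont {a b : ℝ} (ha : a < 0) (hb : 0 < b) {g : ℝ → ℝ}
    (hg : ContinuousOn g (Ioo a b)) (n : ℕ) {t : ℝ} (ht : t ∈ Ioo a b) :
    ContinuousOn (fun u : ℝ => u ^ n * g (t * u ^ 2)) (Icc 0 1) := by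
  refine ContinuousOn.mul (by fun_prop) ?_
  exact hg.comp (by fun_prop) (fun u hu => ssiq_mem ha hb ht (ssiq_sq hu))

theorem ssiq_deriv {a b : ℝ} (ha : a < 0) (hb : 0 < b) {g : ℝ → ℝ}
    (hg : ContDiffOn ℝ (⊤ : ℕ∞) g (Ioo a b)) (n : ℕ) {t : ℝ} (ht : t ∈ Ioo a b) :
    HasDerivAt (fun t => ∫ u in (0:ℝ)..1, u ^ n * g (t * u ^ 2))
      (∫ u in (0:ℝ)..1, u ^ (n + 2) * deriv g (t * u ^ 2)) t := by
  have hg' := ((contDiffOn_infty_iff_deriv_of_isOpen isOpen_Ioo).1 hg)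
  have hgc := hg.continuousOn
  have hgc' := hg'.2.continuousOn
  obtain ⟨c, hc1, hc2⟩ := exists_between (lt_min ha ht.1)
  obtain ⟨d, hd1, hd2⟩ := exists_between (max_lt hb ht.2)
  have hc0 : c < 0 := hc2.trans_le (min_le_left _ _)
  have hct : c < t := hc2.trans_le (min_le_right _ _)
  have hd0 : 0 < d := (le_max_left _ _).trans_lt hd1
  have hdt : t < d := (le_max_right _ _).trans_lt hd1
  have hsub : Icc c d ⊆ Ioo a b := fun x hx => ⟨hc1.trans_le hx.1, hx.2.trans_lt hd2⟩
  obtain ⟨C, hC⟩ := isCompact_Icc.exists_bound_of_continuousOn (hgc'.mono hsub)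
  have hI : Set.uIoc (0:ℝ) 1 ⊆ Icc 0 1 := by
    rw [uIoc_of_le zero_le_one]; exact Ioc_subset_Icc_self
  refine (intervalIntegral.hasDerivAt_integral_of_dominated_loc_of_deriv_le
    (F := fun t u => u ^ n * g (t * u ^ 2))
    (F' := fun t u => u ^ (n + 2) * deriv g (t * u ^ 2)) (bound := fun _ => C)
    (s := Ioo c d) (Ioo_mem_nhds hct hdt) ?_ ?_ ?_ ?_ ?_ ?_).2
  · filter_upwards [Ioo_mem_nhds ht.1 ht.2] with x hx
    exact ((ssiq_cont ha hb hgc n hx).mono hI).aestronglyMeasurable measurableSet_uIoc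
  · apply ContinuousOn.intervalIntegrable
    rw [uIcc_of_le zero_le_one]
    exact ssiq_cont ha hb hgc n ht
  · exact ((ssiq_cont ha hb hgc' (n+2) ht).mono hI).aestronglyMeasurable measurableSet_uIoc
  · refine Filter.Eventually.of_forall fun u hu x hx => ?_
    have hu' := hI hu
    have h1 := hC _ (Ioo_subset_Icc_self (ssiq_mem hc0 hd0 hx (ssiq_sq hu')))
    rw [norm_mul]
    have h2 : ‖u ^ (n + 2)‖ ≤ 1 := by
      rw [Real.norm_of_nonneg (pow_nonneg hu'.1 _)]
      exact pow_le_one₀ hu'.1 hu'.2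
    nlinarith [norm_nonneg (deriv g (x * u ^ 2)), norm_nonneg (u ^ (n + 2))]
  · exact intervalIntegrable_const
  · refine Filter.Eventually.of_forall fun u hu x hx => ?_
    have hm := ssiq_mem ha hb (hsub (Ioo_subset_Icc_self hx)) (ssiq_sq (hI hu))
    have h1 : HasDerivAt g (deriv g (x * u ^ 2)) (x * u ^ 2) :=
      (hg'.1.differentiableAt (isOpen_Ioo.mem_nhds hm)).hasDerivAt
    have h2 : HasDerivAt (fun x : ℝ => x * u ^ 2) (u ^ 2) x := by
      simpa using (hasDerivAt_id x).mul_const (u ^ 2)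
    have h3 := (h1.comp x h2).const_mul (u ^ n)
    exact h3.congr_deriv (by ring)

theorem ssiq_smooth {a b : ℝ} (ha : a < 0) (hb : 0 < b) (m : ℕ) : ∀ (n : ℕ) (g : ℝ → ℝ),
    ContDiffOn ℝ (⊤ : ℕ∞) g (Ioo a b) →
    ContDiffOn ℝ m (fun t => ∫ u in (0:ℝ)..1, u ^ n * g (t * u ^ 2)) (Ioo a b) := by
  induction m with
  | zero =>
    intro n g hg
    rw [Nat.cast_zero, contDiffOn_zero]
    exact fun t ht => (ssiq_deriv ha hb hg n ht).continuousAt.continuousWithinAt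
  | succ m ih =>
    intro n g hg
    rw [Nat.cast_succ, contDiffOn_succ_iff_deriv_of_isOpen isOpen_Ioo]
    refine ⟨fun t ht => (ssiq_deriv ha hb hg n ht).differentiableAt.differentiableWithinAt,
      by simp, ?_⟩
    exact (ih (n + 2) (deriv g)
      ((contDiffOn_infty_iff_deriv_of_isOpen isOpen_Ioo).1 hg).2).congr
      fun t ht => (ssiq_deriv ha hb hg n ht).deriv

theorem ssiq_sub {k : ℝ → ℝ} (hk : ContinuousOn k (Icc 0 1)) :
    ∫ v in (0:ℝ)..1, k v / Real.sqrt v = 2 * ∫ u in (0:ℝ)..1, k (u ^ 2) := by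
  have hksq : ContinuousOn (fun u : ℝ => k (u ^ 2)) (Icc 0 1) :=
    hk.comp (by fun_prop) (fun u hu => ssiq_sq hu)
  have himg : (fun u : ℝ => u ^ 2) '' Icc 0 1 ⊆ Icc 0 1 := by
    rintro _ ⟨u, hu, rfl⟩; exact ssiq_sq hu
  have hpt : ∀ u ∈ Ioc (0:ℝ) 1,
      2 * k (u ^ 2) = ((fun v => k v / Real.sqrt v) ∘ fun u : ℝ => u ^ 2) u * (2 * u) := by
    intro u hu
    have := hu.1.ne'
    simp only [Function.comp, Real.sqrt_sq hu.1.le]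
    field_simp
  have key := intervalIntegral.integral_comp_mul_deriv''' (a := 0) (b := 1)
    (f := fun u : ℝ => u ^ 2) (f' := fun u => 2 * u) (g := fun v => k v / Real.sqrt v)
    (by fun_prop)
    (fun x _ => by simpa using (hasDerivAt_pow 2 x).hasDerivWithinAt)
    (by
      rw [min_eq_left zero_le_one, max_eq_right zero_le_one]
      refine ContinuousOn.div ?_ (by fun_prop) ?_
      · exact hk.mono ((image_mono Ioo_subset_Icc_self).trans himg)
      · rintro _ ⟨u, hu, rfl⟩
        exact (Real.sqrt_pos.2 (pow_pos hu.1 2)).ne')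
    (by
      rw [uIcc_of_le zero_le_one]
      refine MeasureTheory.IntegrableOn.mono_set ?_ himg
      have h1 : IntervalIntegrable (fun v : ℝ => v ^ (-(1/2) : ℝ)) MeasureTheory.volume 0 1 :=
        intervalIntegral.intervalIntegrable_rpow' (by norm_num)
      have h2 := h1.continuousOn_mul (g := k) (by rwa [uIcc_of_le zero_le_one])
      rw [intervalIntegrable_iff_integrableOn_Icc_of_le zero_le_one] at h2
      refine h2.congr_fun (fun v hv => ?_) measurableSet_Icc
      simp only [Real.rpow_neg hv.1, ← Real.sqrt_eq_rpow]
      rw [div_eq_mul_inv])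
    (by
      rw [uIcc_of_le zero_le_one, integrableOn_Icc_iff_integrableOn_Ioc]
      have h2 : MeasureTheory.IntegrableOn (fun u : ℝ => 2 * k (u ^ 2)) (Ioc 0 1) :=
        ((hksq.const_mul 2).integrableOn_Icc).mono_set Ioc_subset_Icc_self
      exact h2.congr_fun hpt measurableSet_Ioc)
  simp only [ne_eq, OfNat.ofNat_ne_zero, not_false_eq_true, zero_pow, one_pow] at key
  rw [← key, ← intervalIntegral.integral_const_mul]
  refine intervalIntegral.integral_congr_ae (Filter.Eventually.of_forall fun u hu => ?_)
  rw [uIoc_of_le zero_le_one] at hu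
  exact (hpt u hu).symm

/-- Functions of the form `h(t) = (f(t)/(sign(t)√|t|))·∫₀ᵗ g(s)/√|s| ds`, with `f`, `g`
smooth and `h(0) = 2f(0)g(0)`, are smooth on an open interval containing `0`. -/
theorem smooth_singular_integral_quotient
    (a b : ℝ) (ha : a < 0) (hb : 0 < b)
    (f g : ℝ → ℝ)
    (hf : ContDiffOn ℝ (⊤ : ℕ∞) f (Ioo a b)) (hg : ContDiffOn ℝ (⊤ : ℕ∞) g (Ioo a b))
    (h : ℝ → ℝ)
    (h0 : h 0 = 2 * f 0 * g 0)
    (hne : ∀ t ∈ Ioo a b, t ≠ 0 →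
      h t = f t / (Real.sign t * Real.sqrt |t|)
        * ∫ s in (0:ℝ)..t, g s / Real.sqrt |s|) :
    ContDiffOn ℝ (⊤ : ℕ∞) h (Ioo a b) := by
  have hG : ContDiffOn ℝ (⊤ : ℕ∞)
      (fun t => ∫ u in (0:ℝ)..1, u ^ 0 * g (t * u ^ 2)) (Ioo a b) :=
    contDiffOn_infty.2 fun m => ssiq_smooth ha hb m 0 g hg
  refine ((contDiffOn_const (c := (2:ℝ))).mul (hf.mul hG)).congr fun t ht => ?_
  simp only [pow_zero, one_mul]
  by_cases h00 : t = 0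
  · subst h00
    simp [h0, mul_assoc]
  rw [hne t ht h00]
  have hk : ContinuousOn (fun v => g (t * v)) (Icc 0 1) :=
    hg.continuousOn.comp (by fun_prop) (fun v hv => ssiq_mem ha hb ht hv)
  have e1 : ∫ s in (0:ℝ)..t, g s / Real.sqrt |s|
      = t * ((Real.sqrt |t|)⁻¹ * ∫ v in (0:ℝ)..1, g (t * v) / Real.sqrt v) := by
    have := intervalIntegral.mul_integral_comp_mul_left (a := 0) (b := 1)
      (f := fun s => g s / Real.sqrt |s|) (c := t)
    rw [mul_zero, mul_one] at this
    rw [← this]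
    congr 1
    rw [← intervalIntegral.integral_const_mul]
    apply intervalIntegral.integral_congr
    intro v hv
    rw [uIcc_of_le zero_le_one] at hv
    simp only [abs_mul, abs_of_nonneg hv.1, Real.sqrt_mul (abs_nonneg t)]
    rw [div_eq_mul_inv, mul_inv, div_eq_mul_inv]
    ring
  rw [e1, ssiq_sub hk]
  have hs : 0 < Real.sqrt |t| := Real.sqrt_pos.2 (abs_pos.2 h00)
  have hss : Real.sqrt |t| ^ 2 = |t| := Real.sq_sqrt (abs_nonneg t)
  generalize (∫ u in (0:ℝ)..1, g (t * u ^ 2)) = J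
  rcases lt_or_gt_of_ne h00 with hn | hp
  · rw [Real.sign_of_neg hn]
    have e : t = -(Real.sqrt |t| ^ 2) := by rw [hss, abs_of_neg hn]; ring
    generalize Real.sqrt |t| = r at *
    generalize f t = y
    rw [e]
    field_simp
  · rw [Real.sign_of_pos hp]
    have e : t = (Real.sqrt |t| ^ 2) := by rw [hss, abs_of_pos hp]
    generalize Real.sqrt |t| = r at *
    generalize f t = y
    rw [e]
    field_simp
end
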